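/- arXiv:1512.02978 — 2 statements merged into one kernel-verified Lean document; each statement's English description precedes it below -/
import Mathlib

section
/- The Boolean lattice 2^{[2m]} admits a partition into C(2m, m) saturated chains such that: (1) every chain has length at most m; (2) exactly C(2m,j) − C(2m,j−1) chains start at level j for each j = 0,...,m; and (3) if two chains A_1 ⊂ ... ⊂ A_r and B_1 ⊂ ... ⊂ B_s in the partition satisfy A_i ⊆ B_j for some i, j, then i ≤ j. -/
open Finset
open scoped Classical

/-- Binomial coefficient with the convention `C n k = 0` for `k < 0`. -/
def binom (n : ℕ) (k : ℤ) : ℕ := if k < 0 then 0 else n.choose k.toNat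

/-- `ch` is a saturated chain of subsets: totally ordered by inclusion and its
cardinalities form an interval of integers. -/
def IsSatChain (ch : Finset (Finset ℕ)) : Prop :=
  ch.Nonempty ∧
  (∀ A ∈ ch, ∀ B ∈ ch, A ⊆ B ∨ B ⊆ A) ∧
  (∀ A ∈ ch, ∀ B ∈ ch, ∀ k : ℕ, A.card ≤ k → k ≤ B.card → ∃ D ∈ ch, D.card = k)

/-- `P` is a partition of the Boolean lattice `2^{[k]}` into saturated chains. -/
def IsChainPartition (k : ℕ) (P : Finset (Finset (Finset ℕ))) : Prop :=
  (∀ ch ∈ P, IsSatChain ch ∧ ch ⊆ (Finset.Icc 1 k).powerset) ∧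
  (∀ A ∈ (Finset.Icc 1 k).powerset, ∃! ch, ch ∈ P ∧ A ∈ ch)

/-- The chain `ch` starts at level `j`: `j` is the smallest cardinality in `ch`. -/
def StartsAt (ch : Finset (Finset ℕ)) (j : ℕ) : Prop :=
  (∃ A ∈ ch, A.card = j) ∧ ∀ B ∈ ch, j ≤ B.card

/-- number of elements of `A` that are at most `t` -/
noncomputable def cnt (A : Finset ℕ) (t : ℕ) : ℕ := (A.filter (fun x => x ≤ t)).card

lemma cnt_zero {m : ℕ} {A : Finset ℕ} (hA : A ⊆ Finset.Icc 1 (2 * m)) : cnt A 0 = 0 := by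
  unfold cnt
  rw [Finset.card_eq_zero, Finset.filter_eq_empty_iff]
  intro x hx
  have := Finset.mem_Icc.1 (hA hx)
  omega

lemma cnt_top {m : ℕ} {A : Finset ℕ} (hA : A ⊆ Finset.Icc 1 (2 * m)) :
    cnt A (2 * m) = A.card := by
  unfold cnt
  rw [Finset.filter_true_of_mem]
  intro x hx
  exact (Finset.mem_Icc.1 (hA hx)).2

lemma cnt_succ (A : Finset ℕ) (t : ℕ) :
    cnt A (t + 1) = cnt A t + if t + 1 ∈ A then 1 else 0 := by
  unfold cnt
  split_ifs with h
  · have : A.filter (fun x => x ≤ t + 1) = insert (t + 1) (A.filter (fun x => x ≤ t)) := by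
      ext x
      simp only [Finset.mem_filter, Finset.mem_insert]
      constructor
      · rintro ⟨h1, h2⟩
        by_cases hx : x = t + 1
        · exact Or.inl hx
        · exact Or.inr ⟨h1, by omega⟩
      · rintro (rfl | ⟨h1, h2⟩)
        · exact ⟨h, le_rfl⟩
        · exact ⟨h1, by omega⟩
    rw [this, Finset.card_insert_of_notMem]
    simp
  · congr 1
    ext x
    simp only [Finset.mem_filter]
    constructor
    · rintro ⟨h1, h2⟩
      refine ⟨h1, ?_⟩
      by_contra hx
      have : x = t + 1 := by omega
      exact h (this ▸ h1)
    · rintro ⟨h1, h2⟩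
      exact ⟨h1, by omega⟩

lemma cnt_mono {A B : Finset ℕ} (h : A ⊆ B) (t : ℕ) : cnt A t ≤ cnt B t :=
  Finset.card_le_card (Finset.filter_subset_filter _ h)

lemma cnt_le_card (A : Finset ℕ) (t : ℕ) : cnt A t ≤ A.card :=
  Finset.card_le_card (Finset.filter_subset _ _)

lemma cnt_le {m : ℕ} {A : Finset ℕ} (hA : A ⊆ Finset.Icc 1 (2 * m)) (t : ℕ) : cnt A t ≤ t := by
  induction t with
  | zero => rw [cnt_zero hA]
  | succ t ih =>
    rw [cnt_succ]
    split_ifs <;> omega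

lemma cnt_insert {D : Finset ℕ} {p : ℕ} (hp : p ∉ D) (t : ℕ) :
    cnt (insert p D) t = cnt D t + if p ≤ t then 1 else 0 := by
  unfold cnt
  rw [Finset.filter_insert]
  split_ifs with h
  · rw [Finset.card_insert_of_notMem]
    simp [hp]
  · rfl

lemma cnt_erase {A : Finset ℕ} {p : ℕ} (hp : p ∈ A) (t : ℕ) :
    cnt A t = cnt (A.erase p) t + if p ≤ t then 1 else 0 := by
  rw [← cnt_insert (Finset.notMem_erase p A), Finset.insert_erase hp]

/-- discrete intermediate value -/
lemma cnt_ivt {m : ℕ} {A : Finset ℕ} (hA : A ⊆ Finset.Icc 1 (2 * m)) (k t : ℕ)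
    (h : k < cnt A t) : ∃ s < t, cnt A s = k := by
  induction t with
  | zero => rw [cnt_zero hA] at h; omega
  | succ t ih =>
    by_cases h' : k < cnt A t
    · obtain ⟨s, hs, e⟩ := ih h'
      exact ⟨s, by omega, e⟩
    · refine ⟨t, by omega, ?_⟩
      rw [cnt_succ] at h
      split_ifs at h <;> omega

/-- the position function -/
noncomputable def pos (m : ℕ) (A : Finset ℕ) : ℕ :=
  ((Finset.range (2 * m + 1)).filter (fun t => cnt A t ≤ m)).sup (fun t => 2 * cnt A t - t)

lemma pos_ge {m : ℕ} {A : Finset ℕ} {t : ℕ} (ht : t ≤ 2 * m) (h : cnt A t ≤ m) :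
    2 * cnt A t ≤ pos m A + t := by
  have : 2 * cnt A t - t ≤ pos m A :=
    Finset.le_sup (f := fun t => 2 * cnt A t - t)
      (Finset.mem_filter.2 ⟨Finset.mem_range.2 (by omega), h⟩)
  omega

lemma pos_le {m : ℕ} {A : Finset ℕ} {c : ℕ}
    (h : ∀ t ≤ 2 * m, cnt A t ≤ m → 2 * cnt A t ≤ c + t) : pos m A ≤ c := by
  unfold pos
  apply Finset.sup_le
  intro t ht
  rw [Finset.mem_filter, Finset.mem_range] at ht
  have := h t (by omega) ht.2
  omega

lemma pos_attained {m : ℕ} {A : Finset ℕ} (hA : A ⊆ Finset.Icc 1 (2 * m)) :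
    ∃ t ≤ 2 * m, cnt A t ≤ m ∧ pos m A + t ≤ 2 * cnt A t := by
  by_contra! hcon
  by_cases h0 : pos m A = 0
  · have := hcon 0 (by omega) (by rw [cnt_zero hA]; omega)
    omega
  · have : pos m A ≤ pos m A - 1 := by
      apply pos_le
      intro t ht h
      have := hcon t ht h
      omega
    omega

lemma pos_le_m {m : ℕ} {A : Finset ℕ} (hA : A ⊆ Finset.Icc 1 (2 * m)) : pos m A ≤ m := by
  apply pos_le
  intro t _ h
  have := cnt_le hA t
  omega

lemma pos_mono {m : ℕ} {A B : Finset ℕ} (hB : B ⊆ Finset.Icc 1 (2 * m)) (h : A ⊆ B) :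
    pos m A ≤ pos m B := by
  apply pos_le
  intro t ht hc
  have hm := cnt_mono h t
  by_cases hb : cnt B t ≤ m
  · have := pos_ge ht hb
    omega
  · obtain ⟨s, hs, e⟩ := cnt_ivt hB m t (by omega)
    have := pos_ge (m := m) (A := B) (t := s) (by omega) (by omega)
    omega

lemma card_le_of_pos_zero {m : ℕ} {A : Finset ℕ} (hA : A ⊆ Finset.Icc 1 (2 * m))
    (h : pos m A = 0) : A.card ≤ m := by
  by_contra hc
  rw [← cnt_top hA] at hc
  obtain ⟨s, hs, e⟩ := cnt_ivt hA m (2 * m) (by omega)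
  have := pos_ge (m := m) (A := A) (t := s) (by omega) (by omega)
  omega

/-- the element removed when going one step down -/
noncomputable def piv (m : ℕ) (A : Finset ℕ) : ℕ :=
  sInf {t | t ≤ 2 * m ∧ cnt A t ≤ m ∧ pos m A + t ≤ 2 * cnt A t}

lemma piv_spec {m : ℕ} {A : Finset ℕ} (hA : A ⊆ Finset.Icc 1 (2 * m)) :
    piv m A ≤ 2 * m ∧ cnt A (piv m A) ≤ m ∧ pos m A + piv m A ≤ 2 * cnt A (piv m A) := by
  have := Nat.sInf_mem (s := {t | t ≤ 2 * m ∧ cnt A t ≤ m ∧ pos m A + t ≤ 2 * cnt A t})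
    (by obtain ⟨t, h1, h2⟩ := pos_attained hA; exact ⟨t, h1, h2⟩)
  exact this

lemma piv_min {m : ℕ} {A : Finset ℕ} {t : ℕ} (ht : t < piv m A) (h1 : t ≤ 2 * m)
    (h2 : cnt A t ≤ m) : 2 * cnt A t < pos m A + t := by
  have := Nat.notMem_of_lt_sInf ht
  by_contra hc
  exact this ⟨h1, h2, by omega⟩

lemma piv_le {m : ℕ} {A : Finset ℕ} {t : ℕ} (h1 : t ≤ 2 * m)
    (h2 : cnt A t ≤ m) (h3 : pos m A + t ≤ 2 * cnt A t) : piv m A ≤ t :=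
  Nat.sInf_le ⟨h1, h2, h3⟩

lemma piv_pos {m : ℕ} {A : Finset ℕ} (hA : A ⊆ Finset.Icc 1 (2 * m)) (h : 1 ≤ pos m A) :
    1 ≤ piv m A := by
  obtain ⟨_, _, h3⟩ := piv_spec hA
  by_contra hc
  have h0 : piv m A = 0 := by omega
  rw [h0, cnt_zero hA] at h3
  omega

lemma piv_mem {m : ℕ} {A : Finset ℕ} (hA : A ⊆ Finset.Icc 1 (2 * m)) (h : 1 ≤ pos m A) :
    piv m A ∈ A := by
  obtain ⟨h1, h2, h3⟩ := piv_spec hA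
  obtain ⟨q, hq⟩ : ∃ q, piv m A = q + 1 := ⟨piv m A - 1, by have := piv_pos hA h; omega⟩
  by_contra hc
  rw [hq] at h1 h2 h3 hc
  rw [cnt_succ, if_neg hc] at h2 h3
  have := piv_min (m := m) (A := A) (t := q) (by omega) (by omega) (by omega)
  omega

/-- one step down -/
noncomputable def dn (m : ℕ) (A : Finset ℕ) : Finset ℕ := A.erase (piv m A)

lemma dn_subset (m : ℕ) (A : Finset ℕ) : dn m A ⊆ A := Finset.erase_subset _ _

lemma dn_card {m : ℕ} {A : Finset ℕ} (hA : A ⊆ Finset.Icc 1 (2 * m)) (h : 1 ≤ pos m A) :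
    (dn m A).card + 1 = A.card := Finset.card_erase_add_one (piv_mem hA h)

lemma cnt_dn {m : ℕ} {A : Finset ℕ} (hA : A ⊆ Finset.Icc 1 (2 * m)) (h : 1 ≤ pos m A) (t : ℕ) :
    cnt A t = cnt (dn m A) t + if piv m A ≤ t then 1 else 0 := cnt_erase (piv_mem hA h) t

lemma pos_dn {m : ℕ} {A : Finset ℕ} (hA : A ⊆ Finset.Icc 1 (2 * m)) (h : 1 ≤ pos m A) :
    pos m (dn m A) + 1 = pos m A := by
  obtain ⟨h1, h2, h3⟩ := piv_spec hA
  have hp := piv_pos hA h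
  have hmem := piv_mem hA h
  apply le_antisymm
  · suffices pos m (dn m A) ≤ pos m A - 1 by omega
    apply pos_le
    intro t ht hc
    have e := cnt_dn hA h t
    by_cases hpt : piv m A ≤ t
    · rw [if_pos hpt] at e
      by_cases hm : cnt A t ≤ m
      · have := pos_ge ht hm
        omega
      · obtain ⟨s, hs, es⟩ := cnt_ivt hA m t (by omega)
        have := pos_ge (m := m) (A := A) (t := s) (by omega) (by omega)
        omega
    · rw [if_neg hpt] at e
      have := piv_min (m := m) (A := A) (t := t) (by omega) ht (by omega)
      omega
  · obtain ⟨q, hq⟩ : ∃ q, piv m A = q + 1 := ⟨piv m A - 1, by omega⟩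
    have e := cnt_dn hA h q
    rw [if_neg (by omega)] at e
    rw [hq] at h1 h2 h3 hmem
    rw [cnt_succ, if_pos hmem] at h2 h3
    have := pos_ge (m := m) (A := dn m A) (t := q) (by omega) (by omega)
    omega

lemma dn_inj_aux {m : ℕ} {A B : Finset ℕ} (hA : A ⊆ Finset.Icc 1 (2 * m))
    (hB : B ⊆ Finset.Icc 1 (2 * m)) (h : 1 ≤ pos m A) (h' : 1 ≤ pos m B)
    (e : dn m A = dn m B) : piv m B ≤ piv m A := by
  by_contra hlt
  have pA := pos_dn hA h
  have pB := pos_dn hB h'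
  rw [e] at pA
  obtain ⟨h1, h2, h3⟩ := piv_spec hB
  have hmem := piv_mem hB h'
  obtain ⟨q, hq⟩ : ∃ q, piv m B = q + 1 := ⟨piv m B - 1, by omega⟩
  have eB := cnt_dn hB h' q
  have eA := cnt_dn hA h q
  rw [if_neg (by omega)] at eB
  rw [if_pos (by omega), e] at eA
  rw [hq] at h1 h2 h3 hmem
  rw [cnt_succ, if_pos hmem] at h2 h3
  have := pos_ge (m := m) (A := A) (t := q) (by omega) (by omega)
  omega

lemma dn_inj {m : ℕ} {A B : Finset ℕ} (hA : A ⊆ Finset.Icc 1 (2 * m))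
    (hB : B ⊆ Finset.Icc 1 (2 * m)) (h : 1 ≤ pos m A) (h' : 1 ≤ pos m B)
    (e : dn m A = dn m B) : A = B := by
  have hp : piv m A = piv m B :=
    le_antisymm (dn_inj_aux hB hA h' h e.symm) (dn_inj_aux hA hB h h' e)
  rw [← Finset.insert_erase (piv_mem hA h), ← Finset.insert_erase (piv_mem hB h')]
  unfold dn at e
  rw [e, hp]

lemma dn_surj {m : ℕ} {D : Finset ℕ} (hD : D ⊆ Finset.Icc 1 (2 * m)) (hc : D.card < m) :
    ∃ B ⊆ Finset.Icc 1 (2 * m), B.card = D.card + 1 ∧ 1 ≤ pos m B ∧ dn m B = D := by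
  have hle : ∀ t, cnt D t ≤ m := fun t => (cnt_le_card D t).trans hc.le
  set S := (Finset.range (2 * m + 1)).filter (fun t => pos m D + t ≤ 2 * cnt D t) with hS
  have hne : S.Nonempty := by
    obtain ⟨t, h1, _, h3⟩ := pos_attained hD
    exact ⟨t, Finset.mem_filter.2 ⟨Finset.mem_range.2 (by omega), h3⟩⟩
  obtain ⟨q, hq, hmax⟩ : ∃ q ∈ S, ∀ t ∈ S, t ≤ q :=
    ⟨S.max' hne, S.max'_mem hne, fun t ht => S.le_max' t ht⟩
  have hlast : ∀ t, q < t → t ≤ 2 * m → 2 * cnt D t < pos m D + t := by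
    intro t h1 h2
    by_contra hcon
    have := hmax t (Finset.mem_filter.2 ⟨Finset.mem_range.2 (by omega), by omega⟩)
    omega
  rw [hS, Finset.mem_filter, Finset.mem_range] at hq
  obtain ⟨hq1, hq2⟩ := hq
  have hq3 : q < 2 * m := by
    have : q ≠ 2 * m := by
      rintro rfl
      rw [cnt_top hD] at hq2
      omega
    omega
  have hnot : q + 1 ∉ D := by
    intro hmem
    have := hlast (q + 1) (by omega) (by omega)
    rw [cnt_succ, if_pos hmem] at this
    omega
  have hB : insert (q + 1) D ⊆ Finset.Icc 1 (2 * m) := by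
    rw [Finset.insert_subset_iff]
    exact ⟨Finset.mem_Icc.2 ⟨by omega, by omega⟩, hD⟩
  have hcard : (insert (q + 1) D).card = D.card + 1 := Finset.card_insert_of_notMem hnot
  have hleB : ∀ t, cnt (insert (q + 1) D) t ≤ m := fun t =>
    (cnt_le_card _ t).trans (by omega)
  have hatq : cnt (insert (q + 1) D) (q + 1) = cnt D q + 1 := by
    rw [cnt_insert hnot, cnt_succ, if_neg hnot, if_pos le_rfl]
  have hpos : pos m (insert (q + 1) D) = pos m D + 1 := by
    apply le_antisymm
    · apply pos_le
      intro t ht _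
      have e := cnt_insert hnot t
      by_cases h : q + 1 ≤ t
      · rw [if_pos h] at e
        have := hlast t (by omega) ht
        omega
      · rw [if_neg h] at e
        have := pos_ge (m := m) (A := D) ht (hle t)
        omega
    · have := pos_ge (m := m) (A := insert (q + 1) D) (t := q + 1) (by omega) (hleB _)
      omega
  have hpiv : piv m (insert (q + 1) D) = q + 1 := by
    apply le_antisymm
    · exact piv_le (by omega) (hleB _) (by omega)
    · by_contra hcon
      obtain ⟨h1, h2, h3⟩ := piv_spec hB
      have e := cnt_insert hnot (piv m (insert (q + 1) D))
      rw [if_neg hcon] at e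
      have := pos_ge (m := m) (A := D) h1 (hle _)
      omega
  refine ⟨_, hB, hcard, by omega, ?_⟩
  unfold dn
  rw [hpiv, Finset.erase_insert hnot]

lemma iter_spec {m : ℕ} (k : ℕ) : ∀ {A : Finset ℕ}, A ⊆ Finset.Icc 1 (2 * m) → k ≤ pos m A →
    (dn m)^[k] A ⊆ A ∧ pos m ((dn m)^[k] A) + k = pos m A ∧
      ((dn m)^[k] A).card + k = A.card := by
  induction k with
  | zero => intro A _ _; simp
  | succ k ih =>
    intro A hA hk
    have h1 : 1 ≤ pos m A := by omega
    have hp := pos_dn hA h1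
    have hc := dn_card hA h1
    obtain ⟨a, b, c⟩ := ih ((dn_subset m A).trans hA) (by omega)
    rw [Function.iterate_succ_apply]
    exact ⟨a.trans (dn_subset m A), by omega, by omega⟩

/-- the bottom of the chain of `A` -/
noncomputable def root (m : ℕ) (A : Finset ℕ) : Finset ℕ := (dn m)^[pos m A] A

lemma root_iter {m : ℕ} {A : Finset ℕ} (hA : A ⊆ Finset.Icc 1 (2 * m)) {k : ℕ}
    (hk : k ≤ pos m A) : root m ((dn m)^[k] A) = root m A := by
  obtain ⟨_, h, _⟩ := iter_spec k hA hk
  unfold root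
  rw [← Function.iterate_add_apply, h]

lemma root_inj {m : ℕ} (n : ℕ) : ∀ {A B : Finset ℕ}, A ⊆ Finset.Icc 1 (2 * m) →
    B ⊆ Finset.Icc 1 (2 * m) → pos m A = n → pos m B = n → root m A = root m B → A = B := by
  induction n with
  | zero =>
    intro A B _ _ h1 h2 h
    unfold root at h
    rw [h1, h2] at h
    exact h
  | succ n ih =>
    intro A B hA hB h1 h2 h
    have pA := pos_dn hA (by omega)
    have pB := pos_dn hB (by omega)
    apply dn_inj hA hB (by omega) (by omega)
    apply ih ((dn_subset m A).trans hA) ((dn_subset m B).trans hB) (by omega) (by omega)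
    have eA := root_iter hA (k := 1) (by omega)
    have eB := root_iter hB (k := 1) (by omega)
    simp only [Function.iterate_one] at eA eB
    rw [eA, eB, h]

lemma root_chain {m : ℕ} {A B : Finset ℕ} (hA : A ⊆ Finset.Icc 1 (2 * m))
    (hB : B ⊆ Finset.Icc 1 (2 * m)) (h : root m A = root m B) (hle : pos m A ≤ pos m B) :
    A ⊆ B := by
  obtain ⟨h1, h2, _⟩ := iter_spec (pos m B - pos m A) hB (by omega)
  have := root_inj (pos m A) hA (h1.trans hB) rfl (by omega)
    (by rw [root_iter hB (by omega), h])
  rw [this]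
  exact h1

lemma root_card {m : ℕ} {A : Finset ℕ} (hA : A ⊆ Finset.Icc 1 (2 * m)) :
    (root m A).card + pos m A = A.card := (iter_spec (pos m A) hA le_rfl).2.2

lemma root_pos {m : ℕ} {A : Finset ℕ} (hA : A ⊆ Finset.Icc 1 (2 * m)) :
    pos m (root m A) = 0 := by
  have := (iter_spec (pos m A) hA le_rfl).2.1
  unfold root
  omega

lemma root_sub {m : ℕ} {A : Finset ℕ} (hA : A ⊆ Finset.Icc 1 (2 * m)) :
    root m A ⊆ Finset.Icc 1 (2 * m) := (iter_spec (pos m A) hA le_rfl).1.trans hA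

lemma root_self {m : ℕ} {A : Finset ℕ} (h : pos m A = 0) : root m A = A := by
  unfold root
  rw [h]
  rfl

/-- the chain with bottom `R` -/
noncomputable def chn (m : ℕ) (R : Finset ℕ) : Finset (Finset ℕ) :=
  (Finset.Icc 1 (2 * m)).powerset.filter (fun A => root m A = R)

/-- the bottoms of the chains -/
noncomputable def bots (m : ℕ) : Finset (Finset ℕ) :=
  (Finset.Icc 1 (2 * m)).powerset.filter (fun A => pos m A = 0)

lemma mem_chn {m : ℕ} {R A : Finset ℕ} :
    A ∈ chn m R ↔ A ⊆ Finset.Icc 1 (2 * m) ∧ root m A = R := by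
  unfold chn
  rw [Finset.mem_filter, Finset.mem_powerset]

lemma mem_bots {m : ℕ} {A : Finset ℕ} :
    A ∈ bots m ↔ A ⊆ Finset.Icc 1 (2 * m) ∧ pos m A = 0 := by
  unfold bots
  rw [Finset.mem_filter, Finset.mem_powerset]

lemma self_mem_chn {m : ℕ} {R : Finset ℕ} (hR : R ∈ bots m) : R ∈ chn m R := by
  rw [mem_bots] at hR
  exact mem_chn.2 ⟨hR.1, root_self hR.2⟩

lemma startsAt_chn {m : ℕ} {R : Finset ℕ} (hR : R ∈ bots m) (j : ℕ) :
    StartsAt (chn m R) j ↔ R.card = j := by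
  have hmin : ∀ B ∈ chn m R, R.card ≤ B.card := by
    intro B hB
    rw [mem_chn] at hB
    have := root_card hB.1
    rw [hB.2] at this
    omega
  constructor
  · rintro ⟨⟨A, hA, rfl⟩, h⟩
    exact le_antisymm (hmin A hA) (h R (self_mem_chn hR))
  · rintro rfl
    exact ⟨⟨R, self_mem_chn hR, rfl⟩, hmin⟩

lemma chn_injOn (m : ℕ) : Set.InjOn (chn m) (bots m : Set (Finset ℕ)) := by
  intro R hR S hS h
  have h1 := self_mem_chn hR
  rw [h, mem_chn] at h1
  rw [← h1.2, root_self (mem_bots.1 hR).2]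

lemma isSat_chn {m : ℕ} {R : Finset ℕ} (hR : R ∈ bots m) : IsSatChain (chn m R) := by
  refine ⟨⟨R, self_mem_chn hR⟩, ?_, ?_⟩
  · intro A hA B hB
    rw [mem_chn] at hA hB
    rcases le_total (pos m A) (pos m B) with h | h
    · exact Or.inl (root_chain hA.1 hB.1 (hA.2.trans hB.2.symm) h)
    · exact Or.inr (root_chain hB.1 hA.1 (hB.2.trans hA.2.symm) h)
  · intro A hA B hB k h1 h2
    rw [mem_chn] at hA hB
    have cA := root_card hA.1
    have cB := root_card hB.1
    rw [hA.2] at cA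
    rw [hB.2] at cB
    obtain ⟨a, _, c⟩ := iter_spec (B.card - k) hB.1 (by omega)
    refine ⟨_, mem_chn.2 ⟨a.trans hB.1, ?_⟩, ?_⟩
    · rw [root_iter hB.1 (by omega), hB.2]
    · omega

lemma card_chn {m : ℕ} (R : Finset ℕ) : (chn m R).card ≤ m + 1 := by
  rw [← Finset.card_range (m + 1)]
  apply Finset.card_le_card_of_injOn (pos m)
  · intro A hA
    have := pos_le_m (mem_chn.1 hA).1
    simp only [Finset.coe_range, Set.mem_Iio]
    omega
  · intro A hA B hB h
    have hA := mem_chn.1 hA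
    have hB := mem_chn.1 hB
    exact root_inj (pos m B) hA.1 hB.1 h rfl (hA.2.trans hB.2.symm)

lemma count_zero (m : ℕ) : ((bots m).filter (fun R => R.card = 0)).card = 1 := by
  rw [Finset.card_eq_one]
  refine ⟨∅, ?_⟩
  ext R
  rw [Finset.mem_filter, mem_bots, Finset.mem_singleton]
  constructor
  · rintro ⟨_, h⟩
    exact Finset.card_eq_zero.1 h
  · rintro rfl
    refine ⟨⟨Finset.empty_subset _, ?_⟩, rfl⟩
    have := root_card (m := m) (Finset.empty_subset (Finset.Icc 1 (2 * m)))
    rw [Finset.card_empty] at this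
    omega

lemma count_succ (m j : ℕ) (hj : j + 1 ≤ m) :
    ((bots m).filter (fun R => R.card = j + 1)).card + (2 * m).choose j =
      (2 * m).choose (j + 1) := by
  have hI : (Finset.Icc 1 (2 * m)).card = 2 * m := by simp
  have e1 : ((Finset.Icc 1 (2 * m)).powersetCard (j + 1)).card = (2 * m).choose (j + 1) := by
    rw [Finset.card_powersetCard, hI]
  have e2 : ((Finset.Icc 1 (2 * m)).powersetCard j).card = (2 * m).choose j := by
    rw [Finset.card_powersetCard, hI]
  rw [← e1, ← e2,
    ← Finset.card_filter_add_card_filter_not (s := (Finset.Icc 1 (2 * m)).powersetCard (j + 1))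
      (fun R => pos m R = 0)]
  congr 1
  · congr 1
    ext R
    rw [Finset.mem_filter, mem_bots, Finset.mem_filter, Finset.mem_powersetCard]
    tauto
  · symm
    apply Finset.card_bij (fun A _ => dn m A)
    · intro A hA
      rw [Finset.mem_filter, Finset.mem_powersetCard] at hA
      obtain ⟨⟨h1, h2⟩, h3⟩ := hA
      have := dn_card h1 (by omega)
      exact Finset.mem_powersetCard.2 ⟨(dn_subset m A).trans h1, by omega⟩
    · intro A hA B hB h
      rw [Finset.mem_filter, Finset.mem_powersetCard] at hA hB
      exact dn_inj hA.1.1 hB.1.1 (by omega) (by omega) h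
    · intro D hD
      rw [Finset.mem_powersetCard] at hD
      obtain ⟨B, h1, h2, h3, h4⟩ := dn_surj hD.1 (by omega)
      exact ⟨B, Finset.mem_filter.2 ⟨Finset.mem_powersetCard.2 ⟨h1, by omega⟩, by omega⟩, h4⟩

lemma count_le (m k : ℕ) (hk : k ≤ m) :
    ((bots m).filter (fun R => R.card ≤ k)).card = (2 * m).choose k := by
  induction k with
  | zero =>
    have := count_zero m
    simpa using this
  | succ k ih =>
    rw [← count_succ m k hk, ← ih (by omega), ← Finset.card_union_of_disjoint]
    · congr 1
      ext R
      simp only [Finset.mem_filter, Finset.mem_union]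
      constructor
      · rintro ⟨h1, h2⟩
        by_cases h : R.card = k + 1
        · exact Or.inl ⟨h1, h⟩
        · exact Or.inr ⟨h1, by omega⟩
      · rintro (⟨h1, h2⟩ | ⟨h1, h2⟩) <;> exact ⟨h1, by omega⟩
    · rw [Finset.disjoint_left]
      intro R h1 h2
      rw [Finset.mem_filter] at h1 h2
      omega

lemma card_bots (m : ℕ) : (bots m).card = (2 * m).choose m := by
  rw [← count_le m m le_rfl, Finset.filter_true_of_mem]
  intro R hR
  rw [mem_bots] at hR
  exact card_le_of_pos_zero hR.1 hR.2

theorem stmt_16 (m : ℕ) :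
    ∃ P : Finset (Finset (Finset ℕ)),
      IsChainPartition (2 * m) P ∧
      P.card = (2 * m).choose m ∧
      -- (1) every chain has length at most m (size at most m+1)
      (∀ ch ∈ P, ch.card ≤ m + 1) ∧
      -- (2) exactly C(2m,j) - C(2m,j-1) chains start at level j, for j = 0,...,m
      (∀ j ≤ m, (P.filter (fun ch => StartsAt ch j)).card =
        (2 * m).choose j - binom (2 * m) ((j : ℤ) - 1)) ∧
      -- (3) if A is the i-th node of one chain and B the j-th node of another and
      -- A ⊆ B, then i ≤ j (the position of a node is its card minus the start level)
      (∀ ch₁ ∈ P, ∀ ch₂ ∈ P, ∀ A ∈ ch₁, ∀ B ∈ ch₂, ∀ a₁ a₂ : ℕ,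
        StartsAt ch₁ a₁ → StartsAt ch₂ a₂ → A ⊆ B →
        A.card - a₁ ≤ B.card - a₂) := by
  refine ⟨(bots m).image (chn m), ⟨?_, ?_⟩, ?_, ?_, ?_, ?_⟩
  · intro ch hch
    obtain ⟨R, hR, rfl⟩ := Finset.mem_image.1 hch
    exact ⟨isSat_chn hR, Finset.filter_subset _ _⟩
  · intro A hA
    rw [Finset.mem_powerset] at hA
    refine ⟨chn m (root m A), ⟨Finset.mem_image_of_mem _ (mem_bots.2 ⟨root_sub hA, root_pos hA⟩),
      mem_chn.2 ⟨hA, rfl⟩⟩, ?_⟩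
    rintro ch ⟨hch, hAc⟩
    obtain ⟨R, hR, rfl⟩ := Finset.mem_image.1 hch
    rw [(mem_chn.1 hAc).2]
  · rw [Finset.card_image_of_injOn (chn_injOn m), card_bots]
  · intro ch hch
    obtain ⟨R, hR, rfl⟩ := Finset.mem_image.1 hch
    exact card_chn R
  · intro j hj
    have e : ((bots m).image (chn m)).filter (fun ch => StartsAt ch j) =
        ((bots m).filter (fun R => R.card = j)).image (chn m) := by
      ext ch
      simp only [Finset.mem_filter, Finset.mem_image]
      constructor
      · rintro ⟨⟨R, hR, rfl⟩, h⟩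
        exact ⟨R, ⟨hR, (startsAt_chn hR j).1 h⟩, rfl⟩
      · rintro ⟨R, ⟨hR, h⟩, rfl⟩
        exact ⟨⟨R, hR, rfl⟩, (startsAt_chn hR j).2 h⟩
    have e2 : (((bots m).image (chn m)).filter (fun ch => StartsAt ch j)).card =
        ((bots m).filter (fun R => R.card = j)).card := by
      rw [e, Finset.card_image_of_injOn]
      exact (chn_injOn m).mono (by
        intro R hR
        exact (Finset.mem_filter.1 hR).1)
    refine Eq.trans ?_ (Eq.trans e2 ?_)
    · congr
    · cases j with
      | zero => rw [count_zero]; simp [binom]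
      | succ j =>
        have := count_succ m j hj
        have hb : binom (2 * m) (((j + 1 : ℕ) : ℤ) - 1) = (2 * m).choose j := by
          have : ((j + 1 : ℕ) : ℤ) - 1 = (j : ℤ) := by push_cast; ring
          rw [this]
          simp [binom]
        rw [hb]
        omega
  · intro ch₁ h₁ ch₂ h₂ A hA B hB a₁ a₂ s₁ s₂ hAB
    obtain ⟨R, hR, rfl⟩ := Finset.mem_image.1 h₁
    obtain ⟨S, hS, rfl⟩ := Finset.mem_image.1 h₂
    have e₁ := (startsAt_chn hR a₁).1 s₁
    have e₂ := (startsAt_chn hS a₂).1 s₂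
    rw [mem_chn] at hA hB
    have c₁ := root_card hA.1
    have c₂ := root_card hB.1
    rw [hA.2] at c₁
    rw [hB.2] at c₂
    have := pos_mono hB.1 hAB
    omega
end

section
/- Let m, l, n be integers with 0 ≤ 2m ≤ l ≤ n−m. Then the minimum width of a cutset in B_n(m, l) satisfies h_n(m, l) ≤ C(n, m) − C(n, m−1). -/
open Finset
open scoped Classical

/-- The truncated Boolean lattice `B_n(m,l)`: subsets of `[n] = {1,...,n}`
of size at least `m` and at most `l`. -/
def truncBool (n m l : ℕ) : Finset (Finset ℕ) :=
  (Finset.Icc 1 n).powerset.filter (fun A => m ≤ A.card ∧ A.card ≤ l)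

/-- `C` is a cutset of `B_n(m,l)`: it is contained in `B_n(m,l)` and meets every
saturated (maximal) chain `A_m ⊂ A_{m+1} ⊂ ⋯ ⊂ A_l` with `|A_i| = i`. -/
def IsCutset (n m l : ℕ) (C : Finset (Finset ℕ)) : Prop :=
  C ⊆ truncBool n m l ∧
  ∀ f : ℕ → Finset ℕ,
    (∀ i, m ≤ i → i ≤ l → f i ⊆ Finset.Icc 1 n ∧ (f i).card = i) →
    (∀ i, m ≤ i → i < l → f i ⊆ f (i + 1)) →
    ∃ i, m ≤ i ∧ i ≤ l ∧ f i ∈ C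

/-- The width of a family of sets: the maximum size of an antichain contained in it. -/
noncomputable def widthF (C : Finset (Finset ℕ)) : ℕ :=
  (C.powerset.filter (fun S : Finset (Finset ℕ) => IsAntichain (· ⊆ ·) (S : Set (Finset ℕ)))).sup
    Finset.card

/-- `hFun n m l` is the minimum width of a cutset in `B_n(m,l)`. -/
noncomputable def hFun (n m l : ℕ) : ℕ :=
  sInf {w | ∃ C : Finset (Finset ℕ), IsCutset n m l C ∧ widthF C = w}

/-- Height at time `k` of the lattice path of `A`. -/
noncomputable def ht (A : Finset ℕ) (k : ℕ) : ℤ := 2 * ((A ∩ Finset.Icc 1 k).card : ℤ) - k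

lemma ht_zero (A : Finset ℕ) : ht A 0 = 0 := by simp [ht]

lemma ht_succ_mem (A : Finset ℕ) (k : ℕ) (h : k + 1 ∈ A) : ht A (k + 1) = ht A k + 1 := by
  have h1 : A ∩ Finset.Icc 1 (k + 1) = insert (k + 1) (A ∩ Finset.Icc 1 k) := by
    ext x
    simp only [Finset.mem_inter, Finset.mem_Icc, Finset.mem_insert]
    constructor
    · rintro ⟨a, b, c⟩
      by_cases hx : x = k + 1
      · exact Or.inl hx
      · exact Or.inr ⟨a, b, by omega⟩
    · rintro (rfl | ⟨a, b, c⟩)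
      · exact ⟨h, by omega, by omega⟩
      · exact ⟨a, b, by omega⟩
  have h2 : (k + 1) ∉ A ∩ Finset.Icc 1 k := by simp
  unfold ht
  rw [h1, Finset.card_insert_of_notMem h2]
  push_cast
  ring

lemma ht_succ_notMem (A : Finset ℕ) (k : ℕ) (h : k + 1 ∉ A) : ht A (k + 1) = ht A k - 1 := by
  have h1 : A ∩ Finset.Icc 1 (k + 1) = A ∩ Finset.Icc 1 k := by
    ext x
    simp only [Finset.mem_inter, Finset.mem_Icc]
    constructor
    · rintro ⟨a, b, c⟩
      have : x ≠ k + 1 := by rintro rfl; exact h a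
      exact ⟨a, b, by omega⟩
    · rintro ⟨a, b, c⟩
      exact ⟨a, b, by omega⟩
  unfold ht
  rw [h1]
  push_cast
  ring

lemma ht_succ_le (A : Finset ℕ) (k : ℕ) : ht A (k + 1) ≤ ht A k + 1 := by
  by_cases h : k + 1 ∈ A
  · rw [ht_succ_mem A k h]
  · rw [ht_succ_notMem A k h]; omega

lemma ht_mono {A B : Finset ℕ} (h : A ⊆ B) (k : ℕ) : ht A k ≤ ht B k := by
  have := Finset.card_le_card (Finset.inter_subset_inter_right h (u := Finset.Icc 1 k))
  unfold ht
  omega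

lemma ht_le (A : Finset ℕ) (k : ℕ) : ht A k ≤ k := by
  have := Finset.card_le_card (Finset.inter_subset_right (s₁ := A) (s₂ := Finset.Icc 1 k))
  simp at this
  unfold ht
  omega

lemma ht_le_card (A : Finset ℕ) (k : ℕ) : ht A k ≤ 2 * A.card - k := by
  have := Finset.card_le_card (Finset.inter_subset_left (s₁ := A) (s₂ := Finset.Icc 1 k))
  unfold ht
  omega

lemma ht_parity (A : Finset ℕ) (k : ℕ) : ∃ c : ℤ, ht A k = 2 * c - k := ⟨_, rfl⟩

lemma ht_insert_lt (B : Finset ℕ) (k i : ℕ) (hi : i < k) : ht (insert k B) i = ht B i := by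
  have : insert k B ∩ Finset.Icc 1 i = B ∩ Finset.Icc 1 i := by
    ext x
    simp only [Finset.mem_inter, Finset.mem_Icc, Finset.mem_insert]
    constructor
    · rintro ⟨rfl | a, b, c⟩
      · omega
      · exact ⟨a, b, c⟩
    · rintro ⟨a, b, c⟩
      exact ⟨Or.inr a, b, c⟩
  unfold ht
  rw [this]

lemma ht_insert_ge (B : Finset ℕ) (k i : ℕ) (h0 : 1 ≤ k) (hk : k ∉ B) (hi : k ≤ i) :
    ht (insert k B) i = ht B i + 2 := by
  have : insert k B ∩ Finset.Icc 1 i = insert k (B ∩ Finset.Icc 1 i) := by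
    rw [Finset.insert_inter_of_mem]
    simp [h0, hi]
  unfold ht
  rw [this, Finset.card_insert_of_notMem (by simp [hk])]
  push_cast
  ring

lemma exists_first_max (h : ℕ → ℤ) (T : ℕ) :
    ∃ k ≤ T, (∀ i < k, h i < h k) ∧ ∀ i ≤ T, h i ≤ h k := by
  induction T with
  | zero => exact ⟨0, le_rfl, by simp, by simp⟩
  | succ T ih =>
    obtain ⟨k, hk, h1, h2⟩ := ih
    by_cases hc : h k < h (T + 1)
    · refine ⟨T + 1, le_rfl, fun i hi => (h2 i (by omega)).trans_lt hc, fun i hi => ?_⟩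
      rcases Nat.lt_or_ge i (T + 1) with hi | hi'
      · exact ((h2 i (by omega)).trans_lt hc).le
      · rw [show i = T + 1 by omega]
    · refine ⟨k, by omega, h1, fun i hi => ?_⟩
      rcases Nat.lt_or_ge i (T + 1) with hi | hi'
      · exact h2 i (by omega)
      · rw [show i = T + 1 by omega]; omega

lemma exists_last_max (h : ℕ → ℤ) (T : ℕ) :
    ∃ k ≤ T, (∀ i ≤ T, k < i → h i < h k) ∧ ∀ i ≤ T, h i ≤ h k := by
  induction T with
  | zero => exact ⟨0, le_rfl, by intros; omega, by simp⟩
  | succ T ih =>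
    obtain ⟨k, hk, h1, h2⟩ := ih
    by_cases hc : h k ≤ h (T + 1)
    · refine ⟨T + 1, le_rfl, by intros; omega, fun i hi => ?_⟩
      rcases Nat.lt_or_ge i (T + 1) with hi | hi'
      · exact ((h2 i (by omega)).trans hc)
      · rw [show i = T + 1 by omega]
    · refine ⟨k, by omega, fun i hi hki => ?_, fun i hi => ?_⟩
      all_goals
        rcases Nat.lt_or_ge i (T + 1) with hi | hi'
        · first | exact h1 i (by omega) hki | exact h2 i (by omega)
        · rw [show i = T + 1 by omega]; omega

/-- `A` is obtained from `B` by adding the element `k`, which is the first time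
at which the path of `A` attains its maximum in the window `[0,T]`. -/
def PRel (T : ℕ) (B A : Finset ℕ) (k : ℕ) : Prop :=
  1 ≤ k ∧ k ≤ T ∧ k ∉ B ∧ A = insert k B ∧
    (∀ i < k, ht A i < ht A k) ∧ ∀ i ≤ T, ht A i ≤ ht A k

lemma PRel.unique_down {T : ℕ} {B B' A : Finset ℕ} {k k' : ℕ}
    (h : PRel T B A k) (h' : PRel T B' A k') : B = B' := by
  obtain ⟨a1, a2, a3, a4, a5, a6⟩ := h
  obtain ⟨b1, b2, b3, b4, b5, b6⟩ := h'
  have : k = k' := by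
    rcases lt_trichotomy k k' with hl | hl | hl
    · have := b5 k hl
      have := a6 k' b2
      omega
    · exact hl
    · have := a5 k' hl
      have := b6 k a2
      omega
  subst this
  rw [← Finset.erase_insert a3, ← Finset.erase_insert b3, ← a4, ← b4]

lemma PRel.lower {T : ℕ} {B A : Finset ℕ} {k : ℕ} (h : PRel T B A k) :
    (∀ i < k, ht B i ≤ ht B (k - 1)) ∧ ∀ i ≤ T, k ≤ i → ht B i ≤ ht B (k - 1) - 1 := by
  obtain ⟨a1, a2, a3, a4, a5, a6⟩ := h
  obtain ⟨p, rfl⟩ : ∃ p, k = p + 1 := ⟨k - 1, by omega⟩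
  simp only [Nat.add_sub_cancel]
  have e1 : ht A (p + 1) = ht A p + 1 := ht_succ_mem A p (by simp [a4])
  have e2 : ht A p = ht B p := by rw [a4]; exact ht_insert_lt B _ _ (by omega)
  constructor
  · intro i hi
    have := a5 i hi
    have e3 : ht A i = ht B i := by rw [a4]; exact ht_insert_lt B _ _ hi
    omega
  · intro i hi hki
    have := a6 i hi
    have e3 : ht A i = ht B i + 2 := by rw [a4]; exact ht_insert_ge B _ _ a1 a3 hki
    omega

lemma PRel.unique_up {T : ℕ} {B A A' : Finset ℕ} {k k' : ℕ}
    (h : PRel T B A k) (h' : PRel T B A' k') : A = A' := by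
  obtain ⟨u1, u2⟩ := h.lower
  obtain ⟨v1, v2⟩ := h'.lower
  obtain ⟨a1, a2, a3, a4, a5, a6⟩ := h
  obtain ⟨b1, b2, b3, b4, b5, b6⟩ := h'
  have : k = k' := by
    rcases lt_trichotomy k k' with hl | hl | hl
    · have := v1 (k - 1) (by omega)
      have := u2 (k' - 1) (by omega) (by omega)
      omega
    · exact hl
    · have := u1 (k' - 1) (by omega)
      have := v2 (k - 1) (by omega) (by omega)
      omega
  rw [a4, b4, this]

lemma exists_rel_down (T : ℕ) (A : Finset ℕ) (h : ∃ i ≤ T, 0 < ht A i) :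
    ∃ B k, PRel T B A k := by
  obtain ⟨k, hk, h1, h2⟩ := exists_first_max (ht A) T
  obtain ⟨i, hi, hpos⟩ := h
  have hk0 : k ≠ 0 := by
    rintro rfl
    have := h2 i hi
    rw [ht_zero] at this
    omega
  obtain ⟨p, rfl⟩ : ∃ p, k = p + 1 := ⟨k - 1, by omega⟩
  have hm : p + 1 ∈ A := by
    by_contra hc
    have := h1 p (by omega)
    rw [ht_succ_notMem A p hc] at this
    omega
  exact ⟨A.erase (p + 1), p + 1, by omega, hk, by simp, (Finset.insert_erase hm).symm, h1, h2⟩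

lemma exists_rel_up (T : ℕ) (B : Finset ℕ) (h : ht B T < 0) :
    ∃ A k, PRel T B A k ∧ 0 < ht A k := by
  obtain ⟨p, hp, h1, h2⟩ := exists_last_max (ht B) T
  have h0 := h2 0 (by omega)
  rw [ht_zero] at h0
  have hpT : p ≠ T := by
    rintro rfl
    omega
  have hlt := h1 (p + 1) (by omega) (by omega)
  have hm : p + 1 ∉ B := by
    intro hc
    rw [ht_succ_mem B p hc] at hlt
    omega
  have e0 := ht_succ_notMem B p hm
  have e1 := ht_insert_ge B (p + 1) (p + 1) (by omega) hm le_rfl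
  refine ⟨insert (p + 1) B, p + 1, ⟨by omega, by omega, hm, rfl, ?_, ?_⟩, by omega⟩
  · intro i hi
    rw [ht_insert_lt B _ _ hi]
    have := h2 i (by omega)
    omega
  · intro i hi
    rcases Nat.lt_or_ge i (p + 1) with hl | hl
    · rw [ht_insert_lt B _ _ hl]
      have := h2 i (by omega)
      omega
    · rw [ht_insert_ge B _ _ (by omega) hm hl]
      have := h1 i hi (by omega)
      omega

/-- Membership in the cutset. -/
def InC (m : ℕ) (A : Finset ℕ) : Prop :=
  m ≤ A.card ∧ A.card ≤ 2 * m ∧ (∀ k ≤ 3 * m - A.card, ht A k ≤ (A.card : ℤ) - m) ∧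
    ∃ k ≤ 3 * m - A.card, ht A k = (A.card : ℤ) - m

lemma InC.down {m : ℕ} {A : Finset ℕ} (h : InC m A) (hA : m < A.card) :
    ∃ B, InC m B ∧ B ⊆ A ∧ B.card + 1 = A.card ∧ ∃ k, PRel (3 * m - A.card) B A k := by
  obtain ⟨h1, h2, h3, k0, hk0, h4⟩ := h
  obtain ⟨B, k, hR⟩ := exists_rel_down (3 * m - A.card) A ⟨k0, hk0, by omega⟩
  obtain ⟨u1, u2⟩ := hR.lower
  have hR' := hR
  obtain ⟨a1, a2, a3, a4, a5, a6⟩ := hR'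
  have hc : A.card = B.card + 1 := by rw [a4, Finset.card_insert_of_notMem a3]
  have hkm : ht A k = (A.card : ℤ) - m := le_antisymm (h3 k a2) (h4 ▸ a6 k0 hk0)
  obtain ⟨p, rfl⟩ : ∃ p, k = p + 1 := ⟨k - 1, by omega⟩
  simp only [Nat.add_sub_cancel] at u1 u2
  have e1 : ht A (p + 1) = ht A p + 1 := ht_succ_mem A p (by simp [a4])
  have e2 : ht A p = ht B p := by rw [a4]; exact ht_insert_lt B _ _ (by omega)
  refine ⟨B, ⟨by omega, by omega, ?_, p, by omega, by omega⟩, ?_, hc.symm, p + 1, hR⟩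
  · have key : ∀ i ≤ 3 * m - A.card, ht B i ≤ (B.card : ℤ) - m := by
      intro i hi
      rcases Nat.lt_or_ge i (p + 1) with hl | hl
      · have := u1 i hl
        omega
      · have := u2 i hi hl
        omega
    intro i hi
    rcases Nat.lt_or_ge (3 * m - A.card) i with hl | hl
    · have hi' : i = (3 * m - A.card) + 1 := by omega
      have := ht_succ_le B (3 * m - A.card)
      have := u2 (3 * m - A.card) le_rfl a2
      rw [hi']
      omega
    · exact key i hl
  · rw [a4]; exact Finset.subset_insert _ _

lemma cut_aux (n m : ℕ) (f : ℕ → Finset ℕ)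
    (hf : ∀ i, m ≤ i → i ≤ 2 * m → f i ⊆ Finset.Icc 1 n ∧ (f i).card = i)
    (hs : ∀ i, m ≤ i → i < 2 * m → f i ⊆ f (i + 1))
    (hno : ∀ i, m ≤ i → i ≤ 2 * m → ¬ InC m (f i)) (j : ℕ) (hj : j ≤ m) :
    ∃ k ≤ 2 * m - j, (j : ℤ) + 1 ≤ ht (f (m + j)) k := by
  have step : ∀ j ≤ m, (∃ k ≤ 2 * m - j, (j : ℤ) ≤ ht (f (m + j)) k) →
      ∃ k ≤ 2 * m - j, (j : ℤ) + 1 ≤ ht (f (m + j)) k := by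
    intro j hj hex
    by_contra! hc
    obtain ⟨k, hk, hk'⟩ := hex
    have hcard := (hf (m + j) (by omega) (by omega)).2
    refine hno (m + j) (by omega) (by omega) ⟨by omega, by omega, ?_, k, by omega, ?_⟩
    · intro i hi
      have := hc i (by omega)
      omega
    · have := hc k hk
      omega
  induction j with
  | zero => exact step 0 hj ⟨0, by omega, by simp [ht_zero]⟩
  | succ j ih =>
    obtain ⟨k, hk, hk'⟩ := ih (by omega)
    apply step _ hj
    have hsub := hs (m + j) (by omega) (by omega)
    rcases Nat.lt_or_ge (2 * m - (j + 1)) k with hl | hl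
    · obtain ⟨c, hc⟩ := ht_parity (f (m + j)) k
      have h1 := ht_succ_le (f (m + j)) (k - 1)
      rw [show k - 1 + 1 = k by omega] at h1
      have h2 := ht_mono hsub (k - 1)
      refine ⟨k - 1, by omega, ?_⟩
      rw [show m + (j + 1) = m + j + 1 by omega]
      push_cast
      omega
    · have h2 := ht_mono hsub k
      refine ⟨k, hl, ?_⟩
      rw [show m + (j + 1) = m + j + 1 by omega]
      push_cast
      omega

/-- The cutset. -/
noncomputable def cutC (n m : ℕ) : Finset (Finset ℕ) :=
  (Finset.Icc 1 n).powerset.filter (InC m)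

lemma cutC_cutset (n m l : ℕ) (h1 : 2 * m ≤ l) : IsCutset n m l (cutC n m) := by
  constructor
  · intro A hA
    simp only [cutC, truncBool, Finset.mem_filter] at hA ⊢
    exact ⟨hA.1, hA.2.1, hA.2.2.1.trans h1⟩
  · intro f hf hs
    by_contra! hc
    obtain ⟨k, hk, hk'⟩ := cut_aux n m f (fun i a b => hf i a (by omega))
      (fun i a b => hs i a (by omega)) (fun i a b hin => hc i a (by omega) (by
        simp only [cutC, Finset.mem_filter, Finset.mem_powerset]
        exact ⟨(hf i a (by omega)).1, hin⟩)) m le_rfl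
    have := ht_le (f (m + m)) k
    omega

lemma exists_g (m : ℕ) : ∃ g : Finset ℕ → Finset ℕ, ∀ A, InC m A → m < A.card →
    InC m (g A) ∧ g A ⊆ A ∧ (g A).card + 1 = A.card ∧ ∃ k, PRel (3 * m - A.card) (g A) A k := by
  have : ∀ A, ∃ B, InC m A → m < A.card →
    InC m B ∧ B ⊆ A ∧ B.card + 1 = A.card ∧ ∃ k, PRel (3 * m - A.card) B A k := by
    intro A
    by_cases h : InC m A ∧ m < A.card
    · obtain ⟨B, hB⟩ := h.1.down h.2
      exact ⟨B, fun _ _ => hB⟩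
    · exact ⟨∅, fun a b => absurd ⟨a, b⟩ h⟩
  choose g hg using this
  exact ⟨g, hg⟩

/-- Existence of the retraction to the bottom level whose fibres are chains. -/
lemma exists_phi (m : ℕ) : ∃ φ : Finset ℕ → Finset ℕ,
    (∀ A, InC m A → InC m (φ A) ∧ φ A ⊆ A ∧ (φ A).card = m) ∧
    ∀ A A', InC m A → InC m A' → A.card ≤ A'.card → φ A = φ A' → A ⊆ A' := by
  obtain ⟨g, hg⟩ := exists_g m
  have iter : ∀ d A, InC m A → A.card = m + d →
      InC m (g^[d] A) ∧ g^[d] A ⊆ A ∧ (g^[d] A).card = m := by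
    intro d
    induction d with
    | zero => intro A h1 h2; exact ⟨h1, by simp, by simpa using h2⟩
    | succ d ih =>
      intro A h1 h2
      obtain ⟨a, b, c, _⟩ := hg A h1 (by omega)
      obtain ⟨a', b', c'⟩ := ih (g A) a (by omega)
      rw [Function.iterate_succ_apply]
      exact ⟨a', b'.trans b, c'⟩
  have inj : ∀ d A A', InC m A → InC m A' → A.card = m + d → A'.card = m + d →
      g^[d] A = g^[d] A' → A = A' := by
    intro d
    induction d with
    | zero => intro A A' _ _ _ _ h; simpa using h
    | succ d ih =>
      intro A A' h1 h1' h2 h2' h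
      obtain ⟨a, b, c, k, hR⟩ := hg A h1 (by omega)
      obtain ⟨a', b', c', k', hR'⟩ := hg A' h1' (by omega)
      rw [Function.iterate_succ_apply, Function.iterate_succ_apply] at h
      have e := ih (g A) (g A') a a' (by omega) (by omega) h
      rw [h2] at hR
      rw [h2', ← e] at hR'
      exact hR.unique_up hR'
  have chain : ∀ e d A A', InC m A → InC m A' → A.card = m + d → A'.card = m + d + e →
      g^[d] A = g^[d + e] A' → A ⊆ A' := by
    intro e
    induction e with
    | zero =>
      intro d A A' h1 h1' h2 h2' h
      rw [inj d A A' h1 h1' h2 h2' h]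
    | succ e ih =>
      intro d A A' h1 h1' h2 h2' h
      obtain ⟨a', b', c', _⟩ := hg A' h1' (by omega)
      rw [show d + (e + 1) = (d + e) + 1 by omega, Function.iterate_succ_apply] at h
      exact (ih d A (g A') h1 a' h2 (by omega) h).trans b'
  refine ⟨fun A => g^[A.card - m] A, ?_, ?_⟩
  · intro A h
    have := h.1
    exact iter _ A h (by omega)
  · intro A A' h h' hle he
    have := h.1
    have := h'.1
    refine chain (A'.card - A.card) (A.card - m) A A' h h' (by omega) (by omega) ?_
    rw [show A.card - m + (A'.card - A.card) = A'.card - m by omega]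
    exact he

/-- The bottom level of the cutset. -/
noncomputable def bot0 (n m : ℕ) : Finset (Finset ℕ) :=
  (Finset.powersetCard m (Finset.Icc 1 n)).filter (InC m)

lemma width_le (n m : ℕ) : widthF (cutC n m) ≤ (bot0 n m).card := by
  obtain ⟨φ, h1, h2⟩ := exists_phi m
  unfold widthF
  apply Finset.sup_le
  intro S hS
  simp only [Finset.mem_filter, Finset.mem_powerset] at hS
  obtain ⟨hSC, hanti⟩ := hS
  have hmem : ∀ A ∈ S, A ⊆ Finset.Icc 1 n ∧ InC m A := by
    intro A hA
    simpa [cutC] using hSC hA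
  apply Finset.card_le_card_of_injOn φ
  · intro A hA
    obtain ⟨a, b⟩ := hmem A hA
    obtain ⟨c, d, e⟩ := h1 A b
    simp only [bot0, Finset.coe_filter, Set.mem_setOf_eq, Finset.mem_powersetCard]
    exact ⟨⟨d.trans a, e⟩, c⟩
  · intro A hA A' hA' he
    by_contra hne
    rcases le_total A.card A'.card with hle | hle
    · exact hanti hA hA' hne (h2 A A' (hmem A hA).2 (hmem A' hA').2 hle he)
    · exact hanti hA' hA (Ne.symm hne) (h2 A' A (hmem A' hA').2 (hmem A hA).2 hle he.symm)

lemma bot0_card (n m : ℕ) (h : 2 * (m + 1) ≤ n) :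
    (bot0 n (m + 1)).card + n.choose m ≤ n.choose (m + 1) := by
  set N := (Finset.powersetCard (m + 1) (Finset.Icc 1 n)).filter
    (fun A => ∃ k ≤ n, 0 < ht A k) with hN
  have hcard : n.choose m ≤ N.card := by
    have e : (Finset.powersetCard m (Finset.Icc 1 n)).card = n.choose m := by simp
    rw [← e]
    have : ∀ B, ∃ A, B ∈ Finset.powersetCard m (Finset.Icc 1 n) →
        ∃ k, PRel n B A k ∧ 0 < ht A k := by
      intro B
      by_cases hB : B ∈ Finset.powersetCard m (Finset.Icc 1 n)
      · have hc := (Finset.mem_powersetCard.1 hB).2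
        have := ht_le_card B n
        obtain ⟨A, hA⟩ := exists_rel_up n B (by omega)
        exact ⟨A, fun _ => hA⟩
      · exact ⟨∅, fun h => absurd h hB⟩
    choose u hu using this
    apply Finset.card_le_card_of_injOn u
    · intro B hB
      obtain ⟨k, ⟨a1, a2, a3, a4, a5, a6⟩, hpos⟩ := hu B hB
      obtain ⟨b1, b2⟩ := Finset.mem_powersetCard.1 hB
      simp only [hN, Finset.coe_filter, Set.mem_setOf_eq, Finset.mem_powersetCard]
      refine ⟨⟨?_, ?_⟩, k, a2, hpos⟩
      · rw [a4]
        exact Finset.insert_subset (by simp [a1, a2]) b1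
      · rw [a4, Finset.card_insert_of_notMem a3, b2]
    · intro B hB B' hB' he
      obtain ⟨k, hR, _⟩ := hu B hB
      obtain ⟨k', hR', _⟩ := hu B' hB'
      rw [← he] at hR'
      exact hR.unique_down hR'
  have hdisj : Disjoint (bot0 n (m + 1)) N := by
    rw [Finset.disjoint_left]
    intro A hA hA'
    simp only [bot0, hN, Finset.mem_filter, Finset.mem_powersetCard] at hA hA'
    obtain ⟨⟨_, hc⟩, _, _, h3, _⟩ := hA
    obtain ⟨_, k, hk, hpos⟩ := hA'
    have := ht_le_card A k
    have := h3 k (by omega)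
    omega
  have hsub : bot0 n (m + 1) ∪ N ⊆ Finset.powersetCard (m + 1) (Finset.Icc 1 n) :=
    Finset.union_subset (Finset.filter_subset _ _) (Finset.filter_subset _ _)
  have := Finset.card_le_card hsub
  rw [Finset.card_union_of_disjoint hdisj] at this
  simp at this
  omega

theorem stmt_19 (n m l : ℕ) (h1 : 2 * m ≤ l) (h2 : l ≤ n - m) :
    hFun n m l ≤ n.choose m - binom n ((m : ℤ) - 1) := by
  have ha : hFun n m l ≤ widthF (cutC n m) := Nat.sInf_le ⟨_, cutC_cutset n m l h1, rfl⟩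
  refine (ha.trans (width_le n m)).trans ?_
  cases m with
  | zero =>
    have : (bot0 n 0).card ≤ (Finset.powersetCard 0 (Finset.Icc 1 n)).card :=
      Finset.card_le_card (Finset.filter_subset _ _)
    simpa [binom] using this
  | succ m =>
    have hb : binom n (((m + 1 : ℕ) : ℤ) - 1) = n.choose m := by
      simp [binom]
    have := bot0_card n m (by omega)
    rw [hb]
    omega
end
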